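/- arXiv:2306.15897 — 6 statements merged into one kernel-verified Lean document; each statement's English description precedes it below -/
import Mathlib

section
/- Let E : [0,∞) → [0,∞) be a nonincreasing function and let φ : [0,∞) → [0,∞) be a strictly increasing function of class C¹ with φ(0) = 0 and φ(t) → +∞ as t → +∞. Suppose there is a constant ω > 0 such that t ↦ E(t)φ'(t) is integrable on [S,∞) and ∫_S^∞ E(t) φ'(t) dt ≤ (1/ω) E(S) for every S ≥ 0. Then E(t) ≤ E(0) e^{1 − ω φ(t)} for all t ≥ 0. -/
open MeasureTheory Filter Set

/-- Discrete Gronwall: exponential decay from a backward Euler inequality. -/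
theorem exp_decay_aux (H : ℝ → ℝ) (ω : ℝ) (hω : 0 < ω)
    (hstep : ∀ a b, 0 ≤ a → a ≤ b → H b * (1 + ω * (b - a)) ≤ H a)
    (y : ℝ) (hy : 0 ≤ y) : H y * Real.exp (ω * y) ≤ H 0 := by
  have hn : ∀ n : ℕ, 0 < n → H y * (1 + ω * y / n) ^ n ≤ H 0 := by
    intro n hn
    have hn' : (0 : ℝ) < n := by exact_mod_cast hn
    have key : ∀ k : ℕ, H (k * (y / n)) * (1 + ω * y / n) ^ k ≤ H 0 := by
      intro k
      induction k with
      | zero => simp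
      | succ k ih =>
        refine le_trans ?_ ih
        have h0 : 0 ≤ y / n := by positivity
        have h1 := hstep (k * (y / n)) ((k + 1 : ℕ) * (y / n)) (by positivity)
          (by push_cast; linarith)
        have h2 : 1 + ω * (((k + 1 : ℕ) : ℝ) * (y / n) - k * (y / n)) = 1 + ω * y / n := by
          push_cast; ring
        rw [h2] at h1
        have h3 : 0 ≤ (1 + ω * y / n) ^ k := by positivity
        calc _ = H ((k + 1 : ℕ) * (y / n)) * (1 + ω * y / n) * (1 + ω * y / n) ^ k := by ring
          _ ≤ _ := mul_le_mul_of_nonneg_right h1 h3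
    have h := key n
    rwa [mul_div_cancel₀ _ hn'.ne'] at h
  have hl := (Real.tendsto_one_add_div_pow_exp (ω * y)).const_mul (H y)
  refine le_of_tendsto hl ?_
  filter_upwards [eventually_gt_atTop 0] with n h using hn n h

/-- Martinez integral decay lemma, case σ = 0: if `E` is nonincreasing and
nonnegative on `[0,∞)`, `φ` is a `C¹` strictly increasing weight with
`φ 0 = 0` and `φ t → ∞`, and `∫_S^∞ E φ' ≤ (1/ω) E S` for all `S ≥ 0`,
then `E t ≤ E 0 * exp (1 - ω φ t)`. -/
theorem stmt0 (E φ : ℝ → ℝ) (ω : ℝ)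
    (hEnonneg : ∀ t, 0 ≤ t → 0 ≤ E t)
    (hEanti : AntitoneOn E (Ici 0))
    (hφmono : StrictMonoOn φ (Ici 0))
    (hφC1 : ContDiffOn ℝ 1 φ (Ici 0))
    (hφ0 : φ 0 = 0)
    (hφnonneg : ∀ t, 0 ≤ t → 0 ≤ φ t)
    (hφtop : Tendsto φ atTop atTop)
    (hω : 0 < ω)
    (hint : ∀ S, 0 ≤ S → IntegrableOn (fun t => E t * deriv φ t) (Ici S))
    (hineq : ∀ S, 0 ≤ S → (∫ t in Ici S, E t * deriv φ t) ≤ (1 / ω) * E S) :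
    ∀ t, 0 ≤ t → E t ≤ E 0 * Real.exp (1 - ω * φ t) := by
  have hcont : ContinuousOn φ (Ici 0) := hφC1.continuousOn
  have hder : ∀ x, 0 < x → HasDerivAt φ (deriv φ x) x := by
    intro x hx
    exact ((hφC1.contDiffAt (Ici_mem_nhds hx)).differentiableAt (by norm_num)).hasDerivAt
  have hdpos : ∀ x, 0 < x → 0 ≤ deriv φ x := by
    intro x hx
    rw [← derivWithin_of_mem_nhds (Ici_mem_nhds hx)]
    exact hφmono.monotoneOn.derivWithin_nonneg
  have hG0 : ∀ S, 0 ≤ S → 0 ≤ ∫ t in Ici S, E t * deriv φ t := by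
    intro S hS
    rw [integral_Ici_eq_integral_Ioi]
    refine setIntegral_nonneg measurableSet_Ioi fun x hx => ?_
    have hx' : 0 < x := lt_of_le_of_lt hS hx
    exact mul_nonneg (hEnonneg x hx'.le) (hdpos x hx')
  have hkey : ∀ a b, 0 ≤ a → a ≤ b → E b * (φ b - φ a) + (∫ t in Ici b, E t * deriv φ t)
      ≤ ∫ t in Ici a, E t * deriv φ t := by
    intro a b ha hab
    have hsub : Icc a b ⊆ Ici 0 := fun x hx => ha.trans hx.1
    have hd : ∀ x ∈ Ioo a b, HasDerivAt φ (deriv φ x) x :=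
      fun x hx => hder x (lt_of_le_of_lt ha hx.1)
    have hi : IntegrableOn (deriv φ) (Ioc a b) :=
      intervalIntegral.integrableOn_deriv_of_nonneg (hcont.mono hsub) hd
        (fun x hx => hdpos x (lt_of_le_of_lt ha hx.1))
    have hftc := intervalIntegral.integral_eq_sub_of_hasDerivAt_of_le hab (hcont.mono hsub) hd
      ((intervalIntegrable_iff_integrableOn_Ioc_of_le hab).2 hi)
    rw [intervalIntegral.integral_of_le hab] at hftc
    have hia := (hint a ha).mono_set Ioi_subset_Ici_self
    have hsplit : ∫ t in Ioi a, E t * deriv φ t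
        = (∫ t in Ioc a b, E t * deriv φ t) + ∫ t in Ioi b, E t * deriv φ t := by
      rw [← Ioc_union_Ioi_eq_Ioi hab]
      exact setIntegral_union (Ioc_disjoint_Ioi le_rfl) measurableSet_Ioi
        (hia.mono_set Ioc_subset_Ioi_self) (hia.mono_set (Ioi_subset_Ioi hab))
    rw [integral_Ici_eq_integral_Ioi, integral_Ici_eq_integral_Ioi, hsplit, ← hftc,
      ← integral_const_mul]
    gcongr ?_ + _
    refine setIntegral_mono_on (hi.const_mul _) (hia.mono_set Ioc_subset_Ioi_self)
      measurableSet_Ioc fun x hx => ?_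
    have hx0 : 0 < x := lt_of_le_of_lt ha hx.1
    exact mul_le_mul_of_nonneg_right (hEanti hx0.le (ha.trans hab) hx.2) (hdpos x hx0)
  have hsurj : ∀ y, ∃ s, 0 ≤ y → 0 ≤ s ∧ φ s = y := by
    intro y
    by_cases hy : 0 ≤ y
    · obtain ⟨T, hT, hT0⟩ := ((hφtop.eventually_ge_atTop y).and (eventually_ge_atTop 0)).exists
      obtain ⟨s, hs, hsy⟩ := intermediate_value_Icc hT0 (hcont.mono Icc_subset_Ici_self)
        (show y ∈ Icc (φ 0) (φ T) from ⟨by rwa [hφ0], hT⟩)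
      exact ⟨s, fun _ => ⟨hs.1, hsy⟩⟩
    · exact ⟨0, fun h => absurd h hy⟩
  choose ψ hψ using hsurj
  have hdecay := exp_decay_aux (fun y => ∫ t in Ici (ψ y), E t * deriv φ t) ω hω (by
    intro a b ha hab
    obtain ⟨h1, h2⟩ := hψ a ha
    obtain ⟨h3, h4⟩ := hψ b (ha.trans hab)
    have hle : ψ a ≤ ψ b := (hφmono.le_iff_le h1 h3).1 (by rw [h2, h4]; exact hab)
    have hk := hkey _ _ h1 hle
    rw [h2, h4] at hk
    have hi := hineq _ h3
    rw [one_div, ← div_eq_inv_mul, le_div_iff₀ hω] at hi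
    have := mul_le_mul_of_nonneg_right hi (sub_nonneg.2 hab)
    linarith)
  intro t ht
  have hE0 := hEnonneg 0 le_rfl
  rcases le_or_gt (ω * φ t) 1 with h | h
  · calc E t ≤ E 0 := hEanti (mem_Ici.2 le_rfl) ht ht
      _ ≤ _ := le_mul_of_one_le_right hE0 (Real.one_le_exp (by linarith))
  · have hy : 0 ≤ φ t - 1 / ω := by
      rw [sub_nonneg, div_le_iff₀ hω]; linarith
    obtain ⟨h1, h2⟩ := hψ _ hy
    obtain ⟨h3, h4⟩ := hψ 0 le_rfl
    have hle : ψ (φ t - 1 / ω) ≤ t := (hφmono.le_iff_le h1 ht).1 (by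
      rw [h2]; have : 0 < 1 / ω := by positivity
      linarith)
    have hk := hkey _ _ h1 hle
    have hd := hdecay _ hy
    have hz : ψ 0 = 0 := hφmono.injOn h3 (mem_Ici.2 le_rfl) (by rw [h4, hφ0])
    simp only [hz] at hd
    have hd2 := hd.trans (hineq 0 le_rfl)
    have hGt := hG0 t ht
    rw [h2] at hk
    have hk2 : E t * (1 / ω) ≤ ∫ t in Ici (ψ (φ t - 1 / ω)), E t * deriv φ t := by
      have : φ t - (φ t - 1 / ω) = 1 / ω := by ring
      rw [this] at hk
      linarith
    have hexp : 0 < Real.exp (ω * (φ t - 1 / ω)) := Real.exp_pos _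
    have h5 := (mul_le_mul_of_nonneg_right hk2 hexp.le).trans hd2
    have h6 : E t * Real.exp (ω * (φ t - 1 / ω)) ≤ E 0 := by
      have hp : 0 < 1 / ω := by positivity
      refine le_of_mul_le_mul_left ?_ hp
      linarith
    have h7 : 1 - ω * φ t = -(ω * (φ t - 1 / ω)) := by field_simp; ring
    rw [h7, Real.exp_neg, ← div_eq_mul_inv, le_div_iff₀ hexp]
    exact h6
end

section
/- Let E : [0,∞) → [0,∞) be a nonincreasing function and let φ : [0,∞) → [0,∞) be a strictly increasing function of class C¹ with φ(0) = 0 and φ(t) → +∞ as t → +∞. Suppose there are constants σ > 0 and ω > 0 such that t ↦ E(t)^{1+σ} φ'(t) is integrable on [S,∞) and ∫_S^∞ E(t)^{1+σ} φ'(t) dt ≤ (1/ω) E(0)^σ E(S) for every S ≥ 0. Then E(t) ≤ E(0) ((1+σ)/(1 + ω σ φ(t)))^{1/σ} for all t ≥ 0. -/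
open MeasureTheory Filter Set

lemma aux_convex (σ x y : ℝ) (hσ : 0 < σ) (hx : 0 < x) (hy : 0 < y) :
    σ * x ^ (-(1 + σ)) * (x - y) ≤ y ^ (-σ) - x ^ (-σ) := by
  have h1 : 1 - σ * (y / x - 1) ≤ (y / x) ^ (-σ) := by
    have hp : 0 < y / x := by positivity
    rw [Real.rpow_def_of_pos hp]
    have := Real.add_one_le_exp (Real.log (y / x) * -σ)
    have h2 := Real.log_le_sub_one_of_pos hp
    nlinarith
  have h3 : (y / x) ^ (-σ) = y ^ (-σ) / x ^ (-σ) := Real.div_rpow hy.le hx.le _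
  have h4 : x ^ (-(1 + σ)) = x ^ (-σ) / x := by
    rw [show -(1 + σ) = -σ - 1 by ring, Real.rpow_sub_one hx.ne']
  have hX : 0 < x ^ (-σ) := Real.rpow_pos_of_pos hx _
  rw [h3, le_div_iff₀ hX] at h1
  rw [h4]
  have : σ * (x ^ (-σ) / x) * (x - y) = (1 - σ * (y / x - 1)) * x ^ (-σ) - x ^ (-σ) := by
    field_simp
    ring
  linarith

lemma aux_ode (u φ : ℝ → ℝ) (σ ω b : ℝ) (hσ : 0 < σ) (hω : 0 < ω) (hb : 0 ≤ b)
    (hu : ContinuousOn u (Icc 0 b)) (hφ : ContinuousOn φ (Icc 0 b))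
    (hpos : ∀ x ∈ Icc 0 b, 0 < u x)
    (hmono : MonotoneOn φ (Icc 0 b))
    (h : ∀ S T, 0 ≤ S → S ≤ T → T ≤ b → u T + ω * u T ^ (1 + σ) * (φ T - φ S) ≤ u S) :
    u 0 ^ (-σ) + σ * ω * (φ b - φ 0) ≤ u b ^ (-σ) := by
  have key : ∀ c, c < σ * ω → u 0 ^ (-σ) + c * (φ b - φ 0) ≤ u b ^ (-σ) := by
    intro c hc
    have hcont : ContinuousOn (fun x => c * φ x - u x ^ (-σ)) (Icc 0 b) :=
      (continuousOn_const.mul hφ).sub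
        (hu.rpow_const (fun x hx => Or.inl (hpos x hx).ne'))
    have := image_le_of_liminf_slope_right_le_deriv_boundary (f := fun x => c * φ x - u x ^ (-σ))
      (B := fun _ => c * φ 0 - u 0 ^ (-σ)) (B' := fun _ => 0) (a := 0) (b := b) hcont le_rfl
      continuousOn_const (fun x _ => hasDerivWithinAt_const _ _ _) ?_ (right_mem_Icc.2 hb)
    · linarith
    · intro x hx r hr
      apply Eventually.frequently
      have hxI : x ∈ Icc 0 b := Ico_subset_Icc_self hx
      have hux := hpos x hxI
      have hnhds : Icc 0 b ∈ nhdsWithin x (Ioi x) :=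
        mem_of_superset (Ioc_mem_nhdsGT hx.2) (fun z hz => ⟨hx.1.trans hz.1.le, hz.2⟩)
      have hut : Tendsto u (nhdsWithin x (Ioi x)) (nhds (u x)) :=
        (hu x hxI).mono_left (nhdsWithin_le_of_mem hnhds)
      have ht : Tendsto (fun z => σ * ω * (u z / u x) ^ (1 + σ)) (nhdsWithin x (Ioi x))
          (nhds (σ * ω * (u x / u x) ^ (1 + σ))) := by
        apply Tendsto.const_mul
        apply Tendsto.rpow_const (hut.div_const _)
        left; rw [div_self hux.ne']; exact one_ne_zero
      rw [div_self hux.ne', Real.one_rpow, mul_one] at ht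
      filter_upwards [ht.eventually_const_lt hc, hnhds, self_mem_nhdsWithin] with z hz hzI hxz
      have hxz' : x < z := hxz
      have huz := hpos z hzI
      refine lt_of_le_of_lt ?_ hr
      rw [slope_def_field]
      apply div_nonpos_of_nonpos_of_nonneg _ (by linarith)
      have h1 := aux_convex σ (u x) (u z) hσ hux huz
      have h2 := h x z hx.1 hxz'.le hzI.2
      have h3 := hmono hxI hzI hxz'.le
      have hP : 0 < u x ^ (-(1 + σ)) := Real.rpow_pos_of_pos hux _
      have h4 : σ * u x ^ (-(1 + σ)) * (ω * u z ^ (1 + σ) * (φ z - φ x))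
          ≤ σ * u x ^ (-(1 + σ)) * (u x - u z) :=
        mul_le_mul_of_nonneg_left (by linarith) (by positivity)
      have h5 : σ * u x ^ (-(1 + σ)) * (ω * u z ^ (1 + σ) * (φ z - φ x))
          = σ * ω * (u z / u x) ^ (1 + σ) * (φ z - φ x) := by
        rw [Real.div_rpow huz.le hux.le, Real.rpow_neg hux.le]
        field_simp
      have h6 : c * (φ z - φ x) ≤ σ * ω * (u z / u x) ^ (1 + σ) * (φ z - φ x) :=
        mul_le_mul_of_nonneg_right hz.le (by linarith)
      linarith
  have hlim : Tendsto (fun c => u 0 ^ (-σ) + c * (φ b - φ 0)) (nhdsWithin (σ * ω) (Iio (σ * ω)))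
      (nhds (u 0 ^ (-σ) + σ * ω * (φ b - φ 0))) := by
    apply Tendsto.mono_left _ nhdsWithin_le_nhds
    exact (Continuous.tendsto (by fun_prop) _)
  exact le_of_tendsto hlim (by filter_upwards [self_mem_nhdsWithin] with c hc using key c hc)

/-- Martinez integral decay lemma, case σ > 0: if `E` is nonincreasing and
nonnegative on `[0,∞)`, `φ` is `C¹` strictly increasing with `φ 0 = 0`,
`φ t → ∞`, and `∫_S^∞ E^{1+σ} φ' ≤ (1/ω) E(0)^σ E S` for all `S ≥ 0`,
then `E t ≤ E 0 * ((1+σ)/(1 + ω σ φ t))^(1/σ)`. -/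
theorem stmt1 (E φ : ℝ → ℝ) (σ ω : ℝ)
    (hEnonneg : ∀ t, 0 ≤ t → 0 ≤ E t)
    (hEanti : AntitoneOn E (Ici 0))
    (hφmono : StrictMonoOn φ (Ici 0))
    (hφC1 : ContDiffOn ℝ 1 φ (Ici 0))
    (hφ0 : φ 0 = 0)
    (hφnonneg : ∀ t, 0 ≤ t → 0 ≤ φ t)
    (hφtop : Tendsto φ atTop atTop)
    (hσ : 0 < σ) (hω : 0 < ω)
    (hint : ∀ S, 0 ≤ S → IntegrableOn (fun t => E t ^ (1 + σ) * deriv φ t) (Ici S))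
    (hineq : ∀ S, 0 ≤ S →
      (∫ t in Ici S, E t ^ (1 + σ) * deriv φ t) ≤ (1 / ω) * E 0 ^ σ * E S) :
    ∀ t, 0 ≤ t → E t ≤ E 0 * ((1 + σ) / (1 + ω * σ * φ t)) ^ (1 / σ) := by
  intro t ht
  have hEt : E t ≤ E 0 := hEanti self_mem_Ici ht ht
  rcases (hEnonneg 0 le_rfl).eq_or_lt with hE0 | hE0
  · rw [← hE0, zero_mul]; rwa [← hE0] at hEt
  have hφt := hφnonneg t ht
  have hX : 0 < 1 + ω * σ * φ t := by positivity
  rcases le_total (1 + ω * σ * φ t) (1 + σ) with hcase | hcase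
  · have h1 : 1 ≤ ((1 + σ) / (1 + ω * σ * φ t)) ^ (1 / σ) :=
      Real.one_le_rpow ((one_le_div hX).2 hcase) (by positivity)
    nlinarith
  have hφcont : ContinuousOn φ (Ici 0) := hφC1.continuousOn
  have hder : ∀ x, 0 < x → HasDerivAt φ (deriv φ x) x := fun x hx =>
    ((hφC1.differentiableOn one_ne_zero).differentiableAt (Ici_mem_nhds hx)).hasDerivAt
  have hder0 : ∀ x, 0 < x → 0 ≤ deriv φ x := by
    intro x hx
    rw [← derivWithin_of_mem_nhds (Ici_mem_nhds hx)]
    exact hφmono.monotoneOn.derivWithin_nonneg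
  set g : ℝ → ℝ := fun t => E t ^ (1 + σ) * deriv φ t with hg
  set f : ℝ → ℝ := fun S => ∫ t in Ici S, g t with hf
  have hgint : ∀ S T, 0 ≤ S → S ≤ T → IntervalIntegrable g volume S T := by
    intro S T hS hST
    rw [intervalIntegrable_iff_integrableOn_Icc_of_le hST]
    exact (hint S hS).mono_set Icc_subset_Ici_self
  have hfsub : ∀ S T, 0 ≤ S → S ≤ T → f S = (∫ x in S..T, g x) + f T := by
    intro S T hS hST
    have : Ici S = Ico S T ∪ Ici T := (Ico_union_Ici_eq_Ici hST).symm
    simp only [hf]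
    rw [this, setIntegral_union _ measurableSet_Ici ((hint S hS).mono_set Ico_subset_Ici_self)
      (hint T (hS.trans hST)), intervalIntegral.integral_of_le hST,
      integral_Ico_eq_integral_Ioc]
    exact Set.disjoint_left.2 (fun x hx hx' => not_lt.2 hx' hx.2)
  have hf0 : ∀ S, 0 ≤ S → 0 ≤ f S := by
    intro S hS
    simp only [hf]
    rw [integral_Ici_eq_integral_Ioi]
    apply setIntegral_nonneg measurableSet_Ioi
    intro x hx
    have hx0 : 0 < x := lt_of_le_of_lt hS hx
    exact mul_nonneg (Real.rpow_nonneg (hEnonneg x hx0.le) _) (hder0 x hx0)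
  have hA : ∀ S T, 0 ≤ S → S ≤ T → E T ^ (1 + σ) * (φ T - φ S) + f T ≤ f S := by
    intro S T hS hST
    rw [hfsub S T hS hST]
    have hc : ContinuousOn φ (Icc S T) := hφcont.mono (fun x hx => hS.trans hx.1)
    have hd : ∀ x ∈ Ioo S T, HasDerivAt φ (deriv φ x) x :=
      fun x hx => hder x (lt_of_le_of_lt hS hx.1)
    have hi : IntervalIntegrable (deriv φ) volume S T := by
      rw [intervalIntegrable_iff_integrableOn_Ioc_of_le hST]
      exact intervalIntegral.integrableOn_deriv_of_nonneg hc hd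
        (fun x hx => hder0 x (lt_of_le_of_lt hS hx.1))
    rw [← intervalIntegral.integral_eq_sub_of_hasDerivAt_of_le hST hc hd hi,
      ← intervalIntegral.integral_const_mul]
    gcongr
    apply intervalIntegral.integral_mono_on_of_le_Ioo hST (hi.const_mul _) (hgint S T hS hST)
    intro x hx
    have hx0 : 0 < x := lt_of_le_of_lt hS hx.1
    apply mul_le_mul_of_nonneg_right _ (hder0 x hx0)
    exact Real.rpow_le_rpow (hEnonneg T (hS.trans hST))
      (hEanti hx0.le (hS.trans hST) hx.2.le) (by positivity)
  -- normalised quantities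
  set K : ℝ := E 0 ^ (1 + σ) / ω with hK
  have hE0p : 0 < E 0 ^ (1 + σ) := Real.rpow_pos_of_pos hE0 _
  have hKpos : 0 < K := by positivity
  have hE0s : E 0 ^ (1 + σ) = E 0 * E 0 ^ σ := by
    rw [Real.rpow_add hE0, Real.rpow_one]
  have hu_le : ∀ S, 0 ≤ S → f S / K ≤ E S / E 0 := by
    intro S hS
    rw [div_le_div_iff₀ hKpos hE0, hK, hE0s]
    have := mul_le_mul_of_nonneg_right (hineq S hS) hE0.le
    calc f S * E 0 ≤ _ := this
      _ = _ := by field_simp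
  have hB : ∀ S T, 0 ≤ S → S ≤ T →
      f T / K + ω * (E T / E 0) ^ (1 + σ) * (φ T - φ S) ≤ f S / K := by
    intro S T hS hST
    have := div_le_div_of_nonneg_right (hA S T hS hST) hKpos.le
    rw [Real.div_rpow (hEnonneg T (hS.trans hST)) hE0.le]
    calc _ = (E T ^ (1 + σ) * (φ T - φ S) + f T) / K := by
          rw [hK]; field_simp; ring
      _ ≤ _ := this
  -- choose S
  set X : ℝ := 1 + ω * σ * φ t with hXdef
  set Y : ℝ := X / (1 + σ) with hY
  have hY1 : 1 ≤ Y := (one_le_div (by positivity)).2 hcase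
  have hYX : Y ≤ X := div_le_self hX.le (by linarith)
  obtain ⟨S, hS, hφS⟩ : ∃ S ∈ Icc 0 t, φ S = (Y - 1) / (ω * σ) := by
    have := intermediate_value_Icc ht (hφcont.mono Icc_subset_Ici_self)
    apply this
    rw [hφ0]
    refine ⟨div_nonneg (by linarith) (by positivity), ?_⟩
    rw [div_le_iff₀ (by positivity)]
    linarith
  have huS : f S / K ≤ Y ^ (-(1 / σ)) := by
    rcases (hf0 S hS.1).eq_or_lt with h0 | h0
    · rw [← h0, zero_div]; positivity
    have hpos : ∀ x ∈ Icc 0 S, 0 < f x / K := by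
      intro x hx
      have h1 := hA x S hx.1 hx.2
      have h2 := hφmono.monotoneOn hx.1 hS.1 hx.2
      have h3 := Real.rpow_nonneg (hEnonneg S hS.1) (1 + σ)
      have h4 := mul_nonneg h3 (sub_nonneg.2 h2)
      exact div_pos (by linarith) hKpos
    have hfc : ContinuousOn f (Icc 0 S) := by
      have h1 : ContinuousOn (fun x => f 0 - ∫ y in (0:ℝ)..x, g y) (Icc 0 S) := by
        apply continuousOn_const.sub
        have := intervalIntegral.continuousOn_primitive_interval
          (f := g) (μ := volume) (a := 0) (b := S)
          (by rw [uIcc_of_le hS.1]; exact (hint 0 le_rfl).mono_set Icc_subset_Ici_self)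
        rwa [uIcc_of_le hS.1] at this
      refine h1.congr (fun x hx => ?_)
      have := hfsub 0 x le_rfl hx.1
      simp only
      linarith
    have hode := aux_ode (fun x => f x / K) φ σ ω S hσ hω hS.1 (hfc.div_const K)
      (hφcont.mono Icc_subset_Ici_self) hpos
      (hφmono.monotoneOn.mono Icc_subset_Ici_self) (by
        intro a b ha hab hbS
        refine le_trans ?_ (hB a b ha hab)
        have h1 := hφmono.monotoneOn ha (ha.trans hab) hab
        have h2 : (f b / K) ^ (1 + σ) ≤ (E b / E 0) ^ (1 + σ) :=
          Real.rpow_le_rpow (hpos b ⟨ha.trans hab, hbS⟩).le (hu_le b (ha.trans hab))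
            (by positivity)
        have h3 : 0 ≤ φ b - φ a := by linarith
        gcongr)
    have hu0 : 1 ≤ (f 0 / K) ^ (-σ) := by
      apply Real.one_le_rpow_of_pos_of_le_one_of_nonpos (hpos 0 ⟨le_rfl, hS.1⟩) _ (by linarith)
      have := hu_le 0 le_rfl
      rwa [div_self hE0.ne'] at this
    have hYle : Y ≤ (f S / K) ^ (-σ) := by
      rw [hφ0, hφS] at hode
      have : σ * ω * ((Y - 1) / (ω * σ) - 0) = Y - 1 := by field_simp; ring
      linarith
    have hp := hpos S ⟨hS.1, le_rfl⟩
    have := Real.rpow_le_rpow_of_nonpos (z := -(1 / σ)) (by linarith) hYle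
      (by have : 0 < 1 / σ := by positivity
          linarith)
    rwa [← Real.rpow_mul hp.le, show -σ * -(1 / σ) = 1 by field_simp, Real.rpow_one] at this
  have hfin := hB S t hS.1 hS.2
  have hft : 0 ≤ f t / K := div_nonneg (hf0 t ht) hKpos.le
  have hYpos : 0 < Y := by linarith
  have he0 : 0 ≤ E t / E 0 := div_nonneg (hEnonneg t ht) hE0.le
  have hdiff : ω * (φ t - φ S) = Y := by
    rw [hφS]
    have : φ t = (X - 1) / (ω * σ) := by rw [hXdef]; field_simp; ring
    rw [this, hY]; field_simp; ring
  have h1 : (E t / E 0) ^ (1 + σ) * Y ≤ Y ^ (-(1 / σ)) := by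
    have h0 : ω * (E t / E 0) ^ (1 + σ) * (φ t - φ S) = (E t / E 0) ^ (1 + σ) * Y := by
      rw [← hdiff]; ring
    linarith
  have h2 : (E t / E 0) ^ (1 + σ) ≤ ((1 / Y) ^ (1 / σ)) ^ (1 + σ) := by
    rw [← Real.rpow_mul (by positivity), one_div Y, Real.inv_rpow hYpos.le,
      ← Real.rpow_neg hYpos.le]
    rw [← le_div_iff₀ hYpos, ← Real.rpow_sub_one hYpos.ne'] at h1
    have h0 : -(1 / σ * (1 + σ)) = -(1 / σ) - 1 := by
      field_simp
      ring
    rw [h0]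
    exact h1
  have h3 : E t / E 0 ≤ (1 / Y) ^ (1 / σ) :=
    (Real.rpow_le_rpow_iff he0 (by positivity) (by positivity)).1 h2
  rw [div_le_iff₀ hE0, mul_comm] at h3
  rw [hY, one_div_div] at h3
  exact h3
end

section
/- Let E : [0,∞) → [0,∞) be a nonincreasing function and let φ : [0,∞) → [0,∞) be a strictly increasing function of class C¹ with φ(0) = 0 and φ(t) → +∞ as t → +∞. Suppose there are constants σ > 0, σ' ≥ 0 and C > 0 such that t ↦ E(t)^{1+σ} φ'(t) is integrable on [S,∞) and ∫_S^∞ E(t)^{1+σ} φ'(t) dt ≤ C E(S)^{1+σ} + (C/(1+φ(S))^{σ'}) E(0)^σ E(S) for every S ≥ 0. Then there exists a constant C' > 0 such that E(t) ≤ E(0) C' / (1+φ(t))^{(1+σ')/σ} for all t > 0. -/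
open MeasureTheory Filter Set

lemma key_ineq (E φ : ℝ → ℝ) (σ : ℝ)
    (hEnonneg : ∀ t, 0 ≤ t → 0 ≤ E t)
    (hEanti : AntitoneOn E (Ici 0))
    (hφmono : StrictMonoOn φ (Ici 0))
    (hφC1 : ContDiffOn ℝ 1 φ (Ici 0))
    (hσ : 0 < σ)
    (hint : ∀ S, 0 ≤ S → IntegrableOn (fun t => E t ^ (1 + σ) * deriv φ t) (Ici S))
    (S T : ℝ) (hS : 0 ≤ S) (hST : S ≤ T) :
    E T ^ (1 + σ) * (φ T - φ S) ≤ ∫ t in Ici S, E t ^ (1 + σ) * deriv φ t := by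
  have hdiff : ∀ t, 0 < t → HasDerivAt φ (deriv φ t) t := fun t ht =>
    ((hφC1.differentiableOn (by norm_num)).differentiableAt (Ici_mem_nhds ht)).hasDerivAt
  have hd0 : ∀ t, 0 < t → 0 ≤ deriv φ t := by
    intro t ht
    rw [← derivWithin_of_mem_nhds (Ici_mem_nhds ht)]
    exact hφmono.monotoneOn.derivWithin_nonneg
  have hcont : ContinuousOn φ (Icc S T) :=
    hφC1.continuousOn.mono (fun x hx => hS.trans hx.1)
  have hI : IntegrableOn (deriv φ) (Ioc S T) :=
    intervalIntegral.integrableOn_deriv_of_nonneg hcont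
      (fun x hx => hdiff x (hS.trans_lt hx.1)) (fun x hx => hd0 x (hS.trans_lt hx.1))
  have hF : ∫ t in Ioc S T, deriv φ t = φ T - φ S := by
    rw [← intervalIntegral.integral_of_le hST]
    exact intervalIntegral.integral_eq_sub_of_hasDerivAt_of_le hST hcont
      (fun x hx => hdiff x (hS.trans_lt hx.1))
      ((intervalIntegrable_iff_integrableOn_Ioc_of_le hST).2 hI)
  rw [integral_Ici_eq_integral_Ioi, ← hF, ← integral_const_mul]
  have hint2 : IntegrableOn (fun t => E t ^ (1 + σ) * deriv φ t) (Ioi S) :=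
    (hint S hS).mono_set Ioi_subset_Ici_self
  calc ∫ t in Ioc S T, E T ^ (1 + σ) * deriv φ t
      ≤ ∫ t in Ioc S T, E t ^ (1 + σ) * deriv φ t := by
        apply setIntegral_mono_on (hI.const_mul _) (hint2.mono_set Ioc_subset_Ioi_self)
          measurableSet_Ioc
        intro t ht
        have h0 : 0 < t := hS.trans_lt ht.1
        apply mul_le_mul_of_nonneg_right _ (hd0 t h0)
        exact Real.rpow_le_rpow (hEnonneg T (hS.trans hST))
          (hEanti h0.le (hS.trans hST) ht.2) (by linarith)
    _ ≤ _ := by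
        apply setIntegral_mono_set hint2 _ Ioc_subset_Ioi_self.eventuallyLE
        refine (ae_restrict_iff' measurableSet_Ioi).2 (Eventually.of_forall fun t ht => ?_)
        have h0 : 0 < t := hS.trans_lt ht
        exact mul_nonneg (Real.rpow_nonneg (hEnonneg t h0.le) _) (hd0 t h0)

lemma step_ineq (σ σ' C e M u Es Et : ℝ) (hσ : 0 < σ) (hC : 0 < C)
    (he : 0 < e) (hM : 0 < M) (hu : 0 < u) (hEs : 0 ≤ Es) (hEt : 0 ≤ Et)
    (h1 : C ≤ 2 ^ (-((1 + σ') / σ) * (1 + σ)) / 2 * u)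
    (h2 : C ≤ 2 ^ (-((1 + σ') / σ) * (1 + σ)) / 2 * M ^ σ)
    (hk : Et ^ (1 + σ) * u ≤ C * Es ^ (1 + σ) + C / u ^ σ' * e ^ σ * Es)
    (hs : Es ≤ e * M / u ^ ((1 + σ') / σ)) :
    Et ≤ e * M / (2 * u) ^ ((1 + σ') / σ) := by
  set p := (1 + σ') / σ with hp
  set B := e * M / u ^ p with hB
  have hB0 : 0 < B := by positivity
  have hBσ : B ^ σ = e ^ σ * M ^ σ / (u * u ^ σ') := by
    rw [hB, Real.div_rpow (by positivity) (by positivity), Real.mul_rpow he.le hM.le,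
      ← Real.rpow_mul hu.le, hp, div_mul_cancel₀ _ hσ.ne', Real.rpow_add hu, Real.rpow_one]
  have hB1 : B ^ (1 + σ) = B * B ^ σ := by rw [Real.rpow_add hB0, Real.rpow_one]
  have hEsB : Es ^ (1 + σ) ≤ B ^ (1 + σ) := Real.rpow_le_rpow hEs hs (by linarith)
  set d := (2:ℝ) ^ (-p * (1 + σ)) with hd
  have hMs : 0 < M ^ σ := by positivity
  have t2 : C / u ^ σ' * e ^ σ * Es ≤ d / 2 * u * B ^ (1 + σ) := by
    calc C / u ^ σ' * e ^ σ * Es ≤ (d / 2 * M ^ σ) / u ^ σ' * e ^ σ * B := by gcongr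
      _ = d / 2 * u * B ^ (1 + σ) := by
        rw [hB1, hBσ]; field_simp
  have t1 : C * Es ^ (1 + σ) ≤ d / 2 * u * B ^ (1 + σ) := by gcongr
  have t3 : Et ^ (1 + σ) ≤ d * B ^ (1 + σ) := by
    have : Et ^ (1 + σ) * u ≤ (d * B ^ (1 + σ)) * u := by linarith
    exact le_of_mul_le_mul_right this hu
  have e1 : e * M / (2 * u) ^ p = 2 ^ (-p) * B := by
    rw [hB, Real.mul_rpow (by norm_num) hu.le, Real.rpow_neg (by norm_num)]
    field_simp
  rw [e1]
  rw [hd, Real.rpow_mul (by norm_num), ← Real.mul_rpow (by positivity) hB0.le] at t3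
  exact (Real.rpow_le_rpow_iff hEt (by positivity) (by linarith)).1 t3

/-- Martinez's second integral decay lemma: under the weighted integral
inequality with constants `σ > 0`, `σ' ≥ 0`, `C > 0`, the energy decays
polynomially: `E t ≤ E 0 * C' / (1 + φ t)^((1+σ')/σ)`. -/
theorem stmt2 (E φ : ℝ → ℝ) (σ σ' C : ℝ)
    (hEnonneg : ∀ t, 0 ≤ t → 0 ≤ E t)
    (hEanti : AntitoneOn E (Ici 0))
    (hφmono : StrictMonoOn φ (Ici 0))
    (hφC1 : ContDiffOn ℝ 1 φ (Ici 0))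
    (hφ0 : φ 0 = 0)
    (hφnonneg : ∀ t, 0 ≤ t → 0 ≤ φ t)
    (hφtop : Tendsto φ atTop atTop)
    (hσ : 0 < σ) (hσ' : 0 ≤ σ') (hC : 0 < C)
    (hint : ∀ S, 0 ≤ S → IntegrableOn (fun t => E t ^ (1 + σ) * deriv φ t) (Ici S))
    (hineq : ∀ S, 0 ≤ S →
      (∫ t in Ici S, E t ^ (1 + σ) * deriv φ t) ≤
        C * E S ^ (1 + σ) + C / (1 + φ S) ^ σ' * E 0 ^ σ * E S) :
    ∃ C' > 0, ∀ t, 0 < t → E t ≤ E 0 * C' / (1 + φ t) ^ ((1 + σ') / σ) := by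
  rcases (hEnonneg 0 le_rfl).eq_or_lt with he | he
  · refine ⟨1, one_pos, fun t ht => ?_⟩
    have := hEanti (mem_Ici.2 le_rfl) (mem_Ici.2 ht.le) ht.le
    rw [← he] at this ⊢
    simpa using this
  set p := (1 + σ') / σ with hp
  have hp0 : 0 < p := by positivity
  set d := (2:ℝ) ^ (-p * (1 + σ)) with hd
  have hd0 : 0 < d := by positivity
  obtain ⟨X, hX1, hX2⟩ : ∃ X : ℝ, 1 ≤ X ∧ C ≤ d / 2 * X := by
    refine ⟨max 1 (C / (d / 2)), le_max_left _ _, ?_⟩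
    rw [← div_le_iff₀' (by positivity)]
    exact le_max_right _ _
  obtain ⟨M, hM0, hM1, hM2⟩ : ∃ M : ℝ, 0 < M ∧ (2 * X) ^ p ≤ M ∧ C ≤ d / 2 * M ^ σ := by
    have h0 : 0 < (2 * X) ^ p := by positivity
    refine ⟨max ((2 * X) ^ p) ((C / (d / 2)) ^ σ⁻¹), lt_max_of_lt_left h0, le_max_left _ _, ?_⟩
    rw [← div_le_iff₀' (by positivity)]
    calc C / (d / 2) = ((C / (d / 2)) ^ σ⁻¹) ^ σ := by
          rw [Real.rpow_inv_rpow (by positivity) hσ.ne']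
      _ ≤ _ := Real.rpow_le_rpow (by positivity) (le_max_right _ _) hσ.le
  have main : ∀ n : ℕ, ∀ t, 0 ≤ t → 1 + φ t ≤ 2 ^ n * (2 * X) →
      E t ≤ E 0 * M / (1 + φ t) ^ p := by
    have base : ∀ t, 0 ≤ t → 1 + φ t ≤ 2 * X → E t ≤ E 0 * M / (1 + φ t) ^ p := by
      intro t ht h
      have hφt := hφnonneg t ht
      have h1 : (1 + φ t) ^ p ≤ M :=
        (Real.rpow_le_rpow (by linarith) h hp0.le).trans hM1
      have h2 : E t ≤ E 0 := hEanti (mem_Ici.2 le_rfl) (mem_Ici.2 ht) ht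
      rw [le_div_iff₀ (by positivity)]
      exact mul_le_mul h2 h1 (by positivity) he.le
    intro n
    induction n with
    | zero => intro t ht h; exact base t ht (by simpa using h)
    | succ n ih =>
      intro t ht h
      by_cases hc : 1 + φ t ≤ 2 * X
      · exact base t ht hc
      push Not at hc
      obtain ⟨s, hs, hsv⟩ : (1 + φ t) / 2 - 1 ∈ φ '' Icc 0 t := by
        apply intermediate_value_Icc ht (hφC1.continuousOn.mono (fun x hx => hx.1))
        constructor <;> rw [hφ0] at * <;> linarith
      have hu : 1 + φ t = 2 * (1 + φ s) := by linarith
      have hXs : X ≤ 1 + φ s := by linarith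
      have hk := (key_ineq E φ σ hEnonneg hEanti hφmono hφC1 hσ hint s t hs.1 hs.2).trans
        (hineq s hs.1)
      have hd1 : φ t - φ s = 1 + φ s := by linarith
      rw [hd1] at hk
      rw [hu]
      refine step_ineq σ σ' C (E 0) M (1 + φ s) (E s) (E t) hσ hC he hM0 (by linarith)
        (hEnonneg s hs.1) (hEnonneg t ht) (hX2.trans ?_) hM2 hk (ih s hs.1 ?_)
      · exact mul_le_mul_of_nonneg_left hXs (by positivity)
      · rw [pow_succ] at h; linarith
  refine ⟨M, hM0, fun t ht => ?_⟩
  obtain ⟨n, hn⟩ := pow_unbounded_of_one_lt (1 + φ t) (one_lt_two (α := ℝ))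
  refine main n t ht.le (hn.le.trans ?_)
  exact le_mul_of_one_le_right (by positivity) (by linarith)
end

section
/- Let μ₀ > 0, K₀ > 0, γ > 0 and define j(λ) = (μ₀/2)λ² − (K₀^{γ+2}/(γ+2))λ^{γ+2}, λ₀ = (μ₀/K₀^{γ+2})^{1/γ}, d₀ = (γμ₀/(2(γ+2)))λ₀². Let E : [0,∞) → ℝ be nonincreasing and F : [0,∞) → [0,∞) be continuous, and assume E(t) ≥ j(F(t)) for all t ≥ 0, E(0) < d₀, and F(0) < λ₀. Then F(t) < λ₀ for all t ≥ 0. -/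
open Set

/-- Potential-well stability (paper's Lemma 4.1): if `E` is nonincreasing,
`F` is continuous and nonnegative, `E t ≥ j (F t)`, `E 0 < d₀` and
`F 0 < l₀`, then `F t < l₀` for all `t ≥ 0`. -/
theorem stmt6 (μ₀ K₀ γ : ℝ) (hμ : 0 < μ₀) (hK : 0 < K₀) (hγ : 0 < γ)
    (E F : ℝ → ℝ)
    (hEanti : AntitoneOn E (Ici 0))
    (hFcont : ContinuousOn F (Ici 0))
    (hFnonneg : ∀ t, 0 ≤ t → 0 ≤ F t) :
    let j : ℝ → ℝ := fun l => μ₀ / 2 * l ^ 2 - K₀ ^ (γ + 2) / (γ + 2) * l ^ (γ + 2)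
    let l₀ : ℝ := (μ₀ / K₀ ^ (γ + 2)) ^ (1 / γ)
    let d₀ : ℝ := γ * μ₀ / (2 * (γ + 2)) * l₀ ^ 2
    (∀ t, 0 ≤ t → j (F t) ≤ E t) → E 0 < d₀ → F 0 < l₀ →
      ∀ t, 0 ≤ t → F t < l₀ := by
  intro j l₀ d₀ hj hE hF t ht
  by_contra hcon
  have hcon' : l₀ ≤ F t := not_lt.mp hcon
  obtain ⟨s, hs, hFs⟩ : l₀ ∈ F '' Icc 0 t :=
    intermediate_value_Icc ht (hFcont.mono Icc_subset_Ici_self) ⟨hF.le, hcon'⟩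
  have hKp : 0 < K₀ ^ (γ + 2) := Real.rpow_pos_of_pos hK _
  have hq : 0 < μ₀ / K₀ ^ (γ + 2) := div_pos hμ hKp
  have hl : 0 < l₀ := Real.rpow_pos_of_pos hq _
  have h1 : l₀ ^ γ = μ₀ / K₀ ^ (γ + 2) := by
    change ((μ₀ / K₀ ^ (γ + 2)) ^ (1 / γ)) ^ γ = _
    rw [← Real.rpow_mul hq.le, one_div_mul_cancel hγ.ne', Real.rpow_one]
  have h2 : l₀ ^ (γ + 2) = μ₀ / K₀ ^ (γ + 2) * l₀ ^ 2 := by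
    rw [Real.rpow_add hl, h1, Real.rpow_two]
  have h3 : j l₀ = d₀ := by
    change μ₀ / 2 * l₀ ^ 2 - K₀ ^ (γ + 2) / (γ + 2) * l₀ ^ (γ + 2)
      = γ * μ₀ / (2 * (γ + 2)) * l₀ ^ 2
    rw [h2]
    generalize K₀ ^ (γ + 2) = A at hKp
    generalize l₀ = l
    have hA := hKp.ne'
    have hg : γ + 2 ≠ 0 := by positivity
    field_simp
    ring
  have h4 := hj s hs.1
  have h5 : E s ≤ E 0 := hEanti (mem_Ici.mpr le_rfl) (mem_Ici.mpr hs.1) hs.1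
  rw [hFs, h3] at h4
  linarith
end

section
/- Let μ₀ > 0, K₀ > 0, γ > 0 and define j(λ) = (μ₀/2)λ² − (K₀^{γ+2}/(γ+2))λ^{γ+2}, λ₀ = (μ₀/K₀^{γ+2})^{1/γ}, d₀ = (γμ₀/(2(γ+2)))λ₀². Let E : [0,∞) → ℝ be nonincreasing and F : [0,∞) → [0,∞) be continuous, and assume E(t) ≥ j(F(t)) for all t ≥ 0, E(0) < d₀, and F(0) < λ₀. Then for all t ≥ 0 one has (μ₀γ/(2(γ+2))) F(t)² ≤ E(t) ≤ E(0). -/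
open Set

/-- Quantitative consequence of potential-well stability: under the
hypotheses of Lemma 4.1, `(μ₀γ/(2(γ+2))) F t ² ≤ E t ≤ E 0` for all `t ≥ 0`. -/
theorem stmt7 (μ₀ K₀ γ : ℝ) (hμ : 0 < μ₀) (hK : 0 < K₀) (hγ : 0 < γ)
    (E F : ℝ → ℝ)
    (hEanti : AntitoneOn E (Ici 0))
    (hFcont : ContinuousOn F (Ici 0))
    (hFnonneg : ∀ t, 0 ≤ t → 0 ≤ F t) :
    let j : ℝ → ℝ := fun l => μ₀ / 2 * l ^ 2 - K₀ ^ (γ + 2) / (γ + 2) * l ^ (γ + 2)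
    let l₀ : ℝ := (μ₀ / K₀ ^ (γ + 2)) ^ (1 / γ)
    let d₀ : ℝ := γ * μ₀ / (2 * (γ + 2)) * l₀ ^ 2
    (∀ t, 0 ≤ t → j (F t) ≤ E t) → E 0 < d₀ → F 0 < l₀ →
      ∀ t, 0 ≤ t → μ₀ * γ / (2 * (γ + 2)) * F t ^ 2 ≤ E t ∧ E t ≤ E 0 := by
  intro j l₀ d₀ hj hE hF t ht
  have hKp : 0 < K₀ ^ (γ + 2) := Real.rpow_pos_of_pos hK _
  have hq : 0 < μ₀ / K₀ ^ (γ + 2) := div_pos hμ hKp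
  have hl₀ : 0 < l₀ := Real.rpow_pos_of_pos hq _
  have hl₀γ : l₀ ^ γ = μ₀ / K₀ ^ (γ + 2) := by
    show ((μ₀ / K₀ ^ (γ + 2)) ^ (1 / γ)) ^ γ = _
    rw [← Real.rpow_mul hq.le, one_div, inv_mul_cancel₀ hγ.ne', Real.rpow_one]
  have key : ∀ l, 0 ≤ l → l ≤ l₀ → μ₀ * γ / (2 * (γ + 2)) * l ^ 2 ≤ j l := by
    intro l h0 h1
    have h2 : l ^ γ ≤ μ₀ / K₀ ^ (γ + 2) := hl₀γ ▸ Real.rpow_le_rpow h0 h1 hγ.le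
    have h3 : K₀ ^ (γ + 2) * l ^ γ ≤ μ₀ := by
      rw [le_div_iff₀ hKp] at h2; linarith
    have h4 : l ^ (γ + 2) = l ^ γ * l ^ 2 := by
      rw [Real.rpow_add_of_nonneg h0 hγ.le (by norm_num), Real.rpow_two]
    have h5 : j l - μ₀ * γ / (2 * (γ + 2)) * l ^ 2
        = (μ₀ - K₀ ^ (γ + 2) * l ^ γ) * l ^ 2 / (γ + 2) := by
      show μ₀ / 2 * l ^ 2 - K₀ ^ (γ + 2) / (γ + 2) * l ^ (γ + 2) - _ = _
      rw [h4]
      generalize K₀ ^ (γ + 2) = A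
      generalize l ^ γ = B
      field_simp
      ring
    have h6 : 0 ≤ (μ₀ - K₀ ^ (γ + 2) * l ^ γ) * l ^ 2 / (γ + 2) :=
      div_nonneg (mul_nonneg (by linarith) (sq_nonneg l)) (by linarith)
    linarith
  have hanti : ∀ s, 0 ≤ s → E s ≤ E 0 := fun s hs =>
    hEanti (mem_Ici.2 le_rfl) (mem_Ici.2 hs) hs
  have hlt : F t < l₀ := by
    by_contra hcon
    push Not at hcon
    obtain ⟨s, hs, hFs⟩ := intermediate_value_Icc ht
      (hFcont.mono Icc_subset_Ici_self) ⟨hF.le, hcon⟩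
    have h1 := hj s hs.1
    rw [hFs] at h1
    have h2 := key l₀ hl₀.le le_rfl
    have h3 := hanti s hs.1
    have h4 : d₀ = μ₀ * γ / (2 * (γ + 2)) * l₀ ^ 2 := by
      show γ * μ₀ / (2 * (γ + 2)) * l₀ ^ 2 = _
      rw [mul_comm γ μ₀]
    linarith
  exact ⟨(key _ (hFnonneg t ht) hlt.le).trans (hj t ht), hanti t ht⟩
end

section
/- Let μ₀ > 0, K₀ > 0, γ > 0 and define j(λ) = (μ₀/2)λ² − (K₀^{γ+2}/(γ+2))λ^{γ+2}, λ₀ = (μ₀/K₀^{γ+2})^{1/γ}, d₀ = (γμ₀/(2(γ+2)))λ₀². Let E : [0,∞) → ℝ be nonincreasing and F : [0,∞) → [0,∞) be continuous, and assume E(t) ≥ j(F(t)) for all t ≥ 0, E(0) < d₀, and F(0) > λ₀. Then F(t) > λ₀ for all t ≥ 0; moreover, if λ₁ denotes the unique λ > λ₀ with j(λ) = E(0) (which exists provided E(0) is in the range of j on (λ₀,∞)), then F(t) ≥ λ₁ for all t ≥ 0. -/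
open Set

/-- Potential-well instability (paper's Lemma 6.1): if `E` is nonincreasing,
`F` continuous and nonnegative, `E t ≥ j (F t)`, `E 0 < d₀` and `F 0 > l₀`,
then `F t > l₀` for all `t ≥ 0`; moreover if `l₁ > l₀` satisfies
`j l₁ = E 0` then `F t ≥ l₁` for all `t ≥ 0`. -/
theorem stmt8 (μ₀ K₀ γ : ℝ) (hμ : 0 < μ₀) (hK : 0 < K₀) (hγ : 0 < γ)
    (E F : ℝ → ℝ)
    (hEanti : AntitoneOn E (Ici 0))
    (hFcont : ContinuousOn F (Ici 0))
    (hFnonneg : ∀ t, 0 ≤ t → 0 ≤ F t) :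
    let j : ℝ → ℝ := fun l => μ₀ / 2 * l ^ 2 - K₀ ^ (γ + 2) / (γ + 2) * l ^ (γ + 2)
    let l₀ : ℝ := (μ₀ / K₀ ^ (γ + 2)) ^ (1 / γ)
    let d₀ : ℝ := γ * μ₀ / (2 * (γ + 2)) * l₀ ^ 2
    (∀ t, 0 ≤ t → j (F t) ≤ E t) → E 0 < d₀ → l₀ < F 0 →
      (∀ t, 0 ≤ t → l₀ < F t) ∧
      (∀ l₁ : ℝ, l₀ < l₁ → j l₁ = E 0 → ∀ t, 0 ≤ t → l₁ ≤ F t) := by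
  intro j l₀ d₀ hj hE0 hF0
  set A : ℝ := K₀ ^ (γ + 2) with hA
  have hApos : 0 < A := Real.rpow_pos_of_pos hK _
  have hq : 0 < μ₀ / A := div_pos hμ hApos
  have hl0 : 0 < l₀ := Real.rpow_pos_of_pos hq _
  have hl0γ : l₀ ^ γ = μ₀ / A := by
    change ((μ₀ / A) ^ (1 / γ)) ^ γ = μ₀ / A
    rw [← Real.rpow_mul hq.le, one_div, inv_mul_cancel₀ hγ.ne', Real.rpow_one]
  have hjl0 : j l₀ = d₀ := by
    change μ₀ / 2 * l₀ ^ 2 - A / (γ + 2) * l₀ ^ (γ + 2) = γ * μ₀ / (2 * (γ + 2)) * l₀ ^ 2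
    have h2 : l₀ ^ (γ + 2) = μ₀ / A * l₀ ^ 2 := by
      rw [Real.rpow_add hl0, hl0γ, Real.rpow_two]
    rw [h2]
    field_simp
    ring
  have hderiv : ∀ x, 0 < x → HasDerivAt j (x * (μ₀ - A * x ^ γ)) x := by
    intro x hx
    have h1 := ((hasDerivAt_pow 2 x).const_mul (μ₀ / 2)).sub
      ((Real.hasDerivAt_rpow_const (x := x) (p := γ + 2) (Or.inl hx.ne')).const_mul (A / (γ + 2)))
    refine h1.congr_deriv ?_
    have h3 : x ^ (γ + 2 - 1) = x ^ γ * x := by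
      rw [show γ + 2 - 1 = γ + 1 by ring, Real.rpow_add hx, Real.rpow_one]
    rw [h3]
    have : γ + 2 ≠ 0 := by positivity
    field_simp
    push_cast
    ring
  have hanti : StrictAntiOn j (Ici l₀) := by
    apply strictAntiOn_of_deriv_neg (convex_Ici l₀)
    · intro x hx
      exact (hderiv x (lt_of_lt_of_le hl0 hx)).continuousAt.continuousWithinAt
    · intro x hx
      rw [interior_Ici] at hx
      have hx' : l₀ < x := hx
      rw [(hderiv x (hl0.trans hx')).deriv]
      have h4 : μ₀ / A < x ^ γ := hl0γ ▸ Real.rpow_lt_rpow hl0.le hx' hγ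
      rw [div_lt_iff₀ hApos] at h4
      exact mul_neg_of_pos_of_neg (hl0.trans hx') (by linarith)
  have hEle : ∀ t, 0 ≤ t → E t ≤ E 0 := fun t ht => hEanti (mem_Ici.2 le_rfl) ht ht
  have hfirst : ∀ t, 0 ≤ t → l₀ < F t := by
    intro t ht
    by_contra hcon
    obtain ⟨s, hs, hFs⟩ := intermediate_value_Icc' ht
      (hFcont.mono Icc_subset_Ici_self) ⟨not_lt.1 hcon, hF0.le⟩
    have h5 := hj s hs.1
    rw [hFs, hjl0] at h5
    linarith [hEle s hs.1]
  refine ⟨hfirst, fun l₁ hl₁ hjl₁ t ht => ?_⟩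
  by_contra hcon
  have h6 := hanti (mem_Ici.2 (hfirst t ht).le) (mem_Ici.2 hl₁.le) (not_le.1 hcon)
  linarith [hj t ht, hEle t ht]
end
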